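/- arXiv:2209.03474 — 2 statements merged into one kernel-verified Lean document; each statement's English description precedes it below -/
import Mathlib

section
/- If T | V ~ N(0, 4V²) where V follows the Kolmogorov distribution (with CDF K(x) = ∑_{j=−∞}^{∞} (−1)^j exp(−2 j² x²) for x > 0), then the marginal distribution of T is standard logistic: f_T(t) = e^{−t}/(1+e^{−t})² for all t ∈ R. -/
open MeasureTheory Real

lemma cs_lintegral (a b : ℝ) (ha : 0 < a) (hb : 0 < b) :
    ENNReal.ofReal (2 * b) * ∫⁻ v in Set.Ioi (0:ℝ), ENNReal.ofReal (exp (-(b * v - a / v) ^ 2))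
      = ENNReal.ofReal (√π) := by
  have hG : ∫⁻ x : ℝ, ENNReal.ofReal (exp (-x ^ 2)) = ENNReal.ofReal (√π) := by
    rw [← ofReal_integral_eq_lintegral_ofReal]
    · have := integral_gaussian 1
      simp at this
      rw [this]
    · have := integrable_exp_neg_mul_sq (b := 1) one_pos
      simpa using this
    · exact Filter.Eventually.of_forall fun x => (exp_pos _).le
  have h1 := lintegral_image_eq_lintegral_abs_deriv_mul (s := Set.Ioi (0:ℝ))
    (f := fun v => b * v - a / v) (f' := fun v => b + a / v ^ 2) measurableSet_Ioi
    (by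
      intro v hv
      have hv : (0:ℝ) < v := hv
      have h := ((hasDerivAt_id v).const_mul b).sub ((hasDerivAt_inv hv.ne').const_mul a)
      refine HasDerivAt.hasDerivWithinAt ?_
      have e : b * 1 - a * -(v ^ 2)⁻¹ = b + a / v ^ 2 := by ring
      rw [e] at h
      exact h)
    (by
      intro x hx y hy h
      have hx : (0:ℝ) < x := hx
      have hy : (0:ℝ) < y := hy
      have h : b * x - a / x = b * y - a / y := h
      field_simp at h
      have : (x - y) * (b * x * y + a) = 0 := by linarith
      rcases mul_eq_zero.1 this with h | h
      · linarith
      · have : 0 < b * x * y := by positivity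
        linarith)
    (fun x => ENNReal.ofReal (exp (-x ^ 2)))
  have himg : (fun v => b * v - a / v) '' Set.Ioi (0:ℝ) = Set.univ := by
    refine Set.eq_univ_of_forall fun w => ?_
    have hs : √(w ^ 2 + 4 * a * b) ^ 2 = w ^ 2 + 4 * a * b := sq_sqrt (by positivity)
    have hlt : |w| < √(w ^ 2 + 4 * a * b) := by
      apply lt_sqrt_of_sq_lt
      rw [sq_abs]
      have : 0 < a * b := by positivity
      linarith
    have hw := neg_abs_le w
    have hpos : 0 < w + √(w ^ 2 + 4 * a * b) := by linarith
    refine ⟨(w + √(w ^ 2 + 4 * a * b)) / (2 * b), by simp only [Set.mem_Ioi]; positivity, ?_⟩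
    simp only
    generalize √(w ^ 2 + 4 * a * b) = s at *
    field_simp
    nlinarith
  rw [himg, Measure.restrict_univ, hG] at h1
  have h2 := lintegral_image_eq_lintegral_abs_deriv_mul (s := Set.Ioi (0:ℝ))
    (f := fun v => (a / b) * v⁻¹) (f' := fun v => (a / b) * (-(v ^ 2)⁻¹)) measurableSet_Ioi
    (by
      intro v hv
      have hv : (0:ℝ) < v := hv
      exact ((hasDerivAt_inv hv.ne').const_mul (a / b)).hasDerivWithinAt)
    (by
      intro x hx y hy h
      have hab : a / b ≠ 0 := by positivity
      exact inv_injective (mul_left_cancel₀ hab h))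
    (fun v => ENNReal.ofReal (exp (-(b * v - a / v) ^ 2)))
  have himg2 : (fun v => (a / b) * v⁻¹) '' Set.Ioi (0:ℝ) = Set.Ioi 0 := by
    ext w
    constructor
    · rintro ⟨v, hv, rfl⟩
      have hv : (0:ℝ) < v := hv
      simp only [Set.mem_Ioi]; positivity
    · intro hw
      have hw : (0:ℝ) < w := hw
      refine ⟨a / b * w⁻¹, by simp only [Set.mem_Ioi]; positivity, ?_⟩
      simp only
      field_simp
  rw [himg2] at h2
  have h3 : ∀ c : ℝ, 0 ≤ c → ∀ F : ℝ → ENNReal, ENNReal.ofReal c * ∫⁻ v in Set.Ioi (0:ℝ), F v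
      = ∫⁻ v in Set.Ioi (0:ℝ), ENNReal.ofReal c * F v := by
    intro c _ F
    rw [lintegral_const_mul' _ _ ENNReal.ofReal_ne_top]
  have h4 : ENNReal.ofReal b * ∫⁻ v in Set.Ioi (0:ℝ), ENNReal.ofReal (exp (-(b * v - a / v) ^ 2))
      = ∫⁻ v in Set.Ioi (0:ℝ), ENNReal.ofReal (a / v ^ 2) * ENNReal.ofReal (exp (-(b * v - a / v) ^ 2)) := by
    rw [h2, h3 b hb.le]
    refine setLIntegral_congr_fun measurableSet_Ioi fun v hv => ?_
    have hv : (0:ℝ) < v := hv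
    rw [← mul_assoc, ← ENNReal.ofReal_mul hb.le]
    congr 2
    · rw [mul_neg, abs_neg, abs_of_pos (by positivity)]
      field_simp
    · congr 1
      field_simp
      ring
  have h5 : ENNReal.ofReal (2 * b) = ENNReal.ofReal b + ENNReal.ofReal b := by
    rw [two_mul, ENNReal.ofReal_add hb.le hb.le]
  rw [h5, add_mul]
  nth_rewrite 2 [h4]
  rw [h3 b hb.le, h1, ← lintegral_add_left (by fun_prop)]
  refine setLIntegral_congr_fun measurableSet_Ioi fun v hv => ?_
  have hv : (0:ℝ) < v := hv
  rw [← add_mul, ← ENNReal.ofReal_add hb.le (by positivity), abs_of_pos (by positivity)]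

noncomputable def nuK (c : ℝ) : Measure ℝ :=
  (volume.restrict (Set.Ioi 0)).withDensity
    (fun v => ENNReal.ofReal (8 * c ^ 2 * v * exp (-2 * c ^ 2 * v ^ 2)))

noncomputable def gK (t v : ℝ) : ℝ := (1 / (2 * v)) *
          ((Real.sqrt (2 * Real.pi))⁻¹ * Real.exp (-(t / (2 * v)) ^ 2 / 2))

lemma measurable_gK (t : ℝ) : Measurable (gK t) := by unfold gK; fun_prop

lemma nuK_Ioi (c x : ℝ) (hc : 0 < c) (hx : 0 < x) :
    nuK c (Set.Ioi x) = ENNReal.ofReal (2 * exp (-2 * c ^ 2 * x ^ 2)) := by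
  have hd : ∀ v ∈ Set.Ici x, HasDerivAt (fun v => -2 * exp (-2 * c ^ 2 * v ^ 2))
      (8 * c ^ 2 * v * exp (-2 * c ^ 2 * v ^ 2)) v := by
    intro v _
    have h := ((((hasDerivAt_pow 2 v).const_mul (-2 * c ^ 2)).exp).const_mul (-2))
    have e : -2 * (exp (-2 * c ^ 2 * v ^ 2) * (-2 * c ^ 2 * (((2:ℕ):ℝ) * v ^ (2 - 1))))
        = 8 * c ^ 2 * v * exp (-2 * c ^ 2 * v ^ 2) := by
      push_cast
      ring
    rw [e] at h
    exact h
  have hpos : ∀ v ∈ Set.Ioi x, 0 ≤ 8 * c ^ 2 * v * exp (-2 * c ^ 2 * v ^ 2) := by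
    intro v hv
    have : 0 < v := hx.trans hv
    positivity
  have hlim : Filter.Tendsto (fun v => -2 * exp (-2 * c ^ 2 * v ^ 2)) Filter.atTop (nhds 0) := by
    have : Filter.Tendsto (fun v : ℝ => -2 * c ^ 2 * v ^ 2) Filter.atTop Filter.atBot :=
      (Filter.tendsto_pow_atTop (two_ne_zero)).const_mul_atTop_of_neg
        (by have : 0 < c ^ 2 := by positivity
            linarith)
    simpa using (Real.tendsto_exp_atBot.comp this).const_mul (-2)
  have hi := integrableOn_Ioi_deriv_of_nonneg' hd hpos hlim
  have hI := integral_Ioi_of_hasDerivAt_of_nonneg' hd hpos hlim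
  rw [nuK, withDensity_apply _ measurableSet_Ioi, Measure.restrict_restrict measurableSet_Ioi,
    Set.inter_eq_self_of_subset_left (Set.Ioi_subset_Ioi hx.le),
    ← ofReal_integral_eq_lintegral_ofReal hi, hI]
  · congr 1; ring
  · exact (ae_restrict_iff' measurableSet_Ioi).2 (Filter.Eventually.of_forall hpos)

lemma lintegral_nuK (c t : ℝ) (hc : 0 < c) (ht : 0 < t) :
    ∫⁻ v, ENNReal.ofReal (gK t v) ∂(nuK c) = ENNReal.ofReal (c * exp (-t) ^ c) := by
  have hcs := cs_lintegral (t / (2 * √2)) (√2 * c) (by positivity) (by positivity)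
  rw [nuK, lintegral_withDensity_eq_lintegral_mul _ (by fun_prop) (measurable_gK t).ennreal_ofReal]
  have : ∀ v ∈ Set.Ioi (0:ℝ), ((fun v => ENNReal.ofReal (8 * c ^ 2 * v * exp (-2 * c ^ 2 * v ^ 2))) *
      fun v => ENNReal.ofReal (gK t v)) v = ENNReal.ofReal (c * exp (-t) ^ c / √π) *
      (ENNReal.ofReal (2 * (√2 * c)) *
      ENNReal.ofReal (exp (-(√2 * c * v - t / (2 * √2) / v) ^ 2))) := by
    intro v hv
    have hv : 0 < v := hv
    simp only [Pi.mul_apply]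
    rw [← ENNReal.ofReal_mul (by positivity), ← ENNReal.ofReal_mul (by positivity),
      ← ENNReal.ofReal_mul (by positivity)]
    congr 1
    have h2 : √2 ^ 2 = 2 := sq_sqrt (by norm_num)
    have he : exp (-2 * c ^ 2 * v ^ 2) * exp (-(t / (2 * v)) ^ 2 / 2)
        = exp (-t) ^ c * exp (-(√2 * c * v - t / (2 * √2) / v) ^ 2) := by
      rw [← exp_mul, ← exp_add, ← exp_add]
      congr 1
      have : (√2 * c * v - t / (2 * √2) / v) ^ 2 = √2 ^ 2 * c ^ 2 * v ^ 2 - c * t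
         + t ^ 2 / (4 * √2 ^ 2 * v ^ 2) := by
        field_simp
        ring
      rw [this, h2]
      field_simp
      ring
    have hpi : √(2 * π) = √2 * √π := sqrt_mul (by norm_num) _
    calc _ = (8 * c ^ 2 * v * (1 / (2 * v)) * (√(2 * π))⁻¹) *
           (exp (-2 * c ^ 2 * v ^ 2) * exp (-(t / (2 * v)) ^ 2 / 2)) := by unfold gK; ring
      _ = _ := by
        rw [he, hpi]
        have h3 : (√2)⁻¹ = √2 / 2 := by field_simp; linarith
        rw [mul_inv, h3]
        field_simp
        ring
  rw [setLIntegral_congr_fun measurableSet_Ioi this, lintegral_const_mul' _ _ ENNReal.ofReal_ne_top,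
    lintegral_const_mul' _ _ ENNReal.ofReal_ne_top, hcs, ← ENNReal.ofReal_mul (by positivity)]
  congr 1
  field_simp

lemma summable_K (x : ℝ) (hx : 0 < x) :
    Summable fun n : ℕ => exp (-2 * ((n : ℝ) + 1) ^ 2 * x ^ 2) := by
  have hr : exp (-2 * x ^ 2) < 1 := by
    rw [exp_lt_one_iff]; nlinarith [pow_pos hx 2]
  refine Summable.of_nonneg_of_le (fun n => (exp_pos _).le) (fun n => ?_)
    (summable_geometric_of_lt_one (exp_pos _).le hr)
  rw [← exp_nat_mul]
  apply exp_le_exp.2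
  have h1 : (n : ℝ) ≤ ((n : ℝ) + 1) ^ 2 := by nlinarith [Nat.cast_nonneg (α := ℝ) n]
  nlinarith [mul_le_mul_of_nonneg_right h1 (pow_pos hx 2).le]

lemma K_identity (x : ℝ) (hx : 0 < x) :
    1 - (∑' j : ℤ, (-1 : ℝ) ^ j * Real.exp (-2 * (j : ℝ) ^ 2 * x ^ 2))
      + ∑' m : ℕ, 2 * exp (-2 * (2 * (m : ℝ) + 2) ^ 2 * x ^ 2)
      = ∑' m : ℕ, 2 * exp (-2 * (2 * (m : ℝ) + 1) ^ 2 * x ^ 2) := by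
  have hs := summable_K x hx
  have ho : Summable fun m : ℕ => exp (-2 * (2 * (m : ℝ) + 1) ^ 2 * x ^ 2) := by
    have := hs.comp_injective (i := fun m : ℕ => 2 * m) (fun a b h => by simpa using h)
    refine this.congr fun m => ?_
    simp
  have he : Summable fun m : ℕ => exp (-2 * (2 * (m : ℝ) + 2) ^ 2 * x ^ 2) := by
    have := hs.comp_injective (i := fun m : ℕ => 2 * m + 1) (fun a b h => by simpa using h)
    refine this.congr fun m => ?_
    simp only [Function.comp]
    push_cast
    ring_nf
  set A := ∑' m : ℕ, exp (-2 * (2 * (m : ℝ) + 1) ^ 2 * x ^ 2) with hA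
  set B := ∑' m : ℕ, exp (-2 * (2 * (m : ℝ) + 2) ^ 2 * x ^ 2) with hB
  have hN : HasSum (fun n : ℕ => (-1 : ℝ) ^ (n + 1) * exp (-2 * ((n : ℝ) + 1) ^ 2 * x ^ 2))
      (-A + B) := by
    apply HasSum.even_add_odd
    · refine HasSum.congr_fun ho.hasSum.neg fun m => ?_
      rw [Odd.neg_one_pow ⟨m, rfl⟩]
      push_cast
      ring
    · convert he.hasSum using 2 with m
      rw [Even.neg_one_pow ⟨m + 1, by ring⟩]
      push_cast
      ring_nf
  have hZ : HasSum (fun j : ℤ => (-1 : ℝ) ^ j * Real.exp (-2 * (j : ℝ) ^ 2 * x ^ 2))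
      ((-A + B) + 1 + (-A + B)) := by
    have := HasSum.of_add_one_of_neg_add_one
      (f := fun j : ℤ => (-1 : ℝ) ^ j * Real.exp (-2 * (j : ℝ) ^ 2 * x ^ 2))
      (m := -A + B) (m' := -A + B) ?_ ?_
    · simpa using this
    · convert hN using 2 with n
      push_cast
      norm_cast
    · convert hN using 2 with n
      rw [zpow_neg, ← inv_zpow, inv_neg_one]
      push_cast
      norm_cast
  rw [hZ.tsum_eq, tsum_mul_left, tsum_mul_left, ← hA, ← hB]
  ring

lemma meas_eq (μK : Measure ℝ) [IsProbabilityMeasure μK]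
    (hK : ∀ x : ℝ, 0 < x →
      (μK (Set.Iic x)).toReal = ∑' j : ℤ, (-1 : ℝ) ^ j * Real.exp (-2 * (j : ℝ) ^ 2 * x ^ 2)) :
    (μK + Measure.sum fun m : ℕ => nuK (2 * m + 2)).restrict (Set.Ioi 0)
      = (Measure.sum fun m : ℕ => nuK (2 * m + 1)).restrict (Set.Ioi 0) := by
  have hs : ∀ x : ℝ, 0 < x → ∀ c : ℕ → ℝ, (∀ m : ℕ, (m : ℝ) + 1 ≤ c m) →
      (Measure.sum fun m : ℕ => nuK (c m)) (Set.Ioi x)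
        = ENNReal.ofReal (∑' m : ℕ, 2 * exp (-2 * (c m) ^ 2 * x ^ 2)) := by
    intro x hx c hc
    have hsum : Summable fun m : ℕ => 2 * exp (-2 * (c m) ^ 2 * x ^ 2) := by
      refine ((summable_K x hx).mul_left 2).of_nonneg_of_le (fun n => by positivity) fun n => ?_
      have h0 : (0:ℝ) ≤ (n:ℝ) + 1 := by positivity
      have h1 := pow_le_pow_left₀ h0 (hc n) 2
      have h2 := mul_le_mul_of_nonneg_right h1 (pow_pos hx 2).le
      gcongr 2 * exp ?_
      linarith
    rw [Measure.sum_apply _ measurableSet_Ioi, ENNReal.ofReal_tsum_of_nonneg (fun n => by positivity) hsum]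
    refine tsum_congr fun m => nuK_Ioi _ _ ?_ hx
    have := hc m
    have h0 : (0:ℝ) ≤ (m:ℝ) := by positivity
    linarith
  have hIoi : ∀ x : ℝ, 0 < x → (μK + Measure.sum fun m : ℕ => nuK (2 * m + 2)) (Set.Ioi x)
      = (Measure.sum fun m : ℕ => nuK (2 * m + 1)) (Set.Ioi x) ∧
      (Measure.sum fun m : ℕ => nuK (2 * m + 1)) (Set.Ioi x) ≠ ⊤ := by
    intro x hx
    have h1 := hs x hx (fun m => 2 * m + 1) (fun m => by
      have h0 : (0:ℝ) ≤ (m:ℝ) := by positivity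
      linarith)
    have h2 := hs x hx (fun m => 2 * m + 2) (fun m => by
      have h0 : (0:ℝ) ≤ (m:ℝ) := by positivity
      linarith)
    refine ⟨?_, by rw [h1]; exact ENNReal.ofReal_ne_top⟩
    have h3 : μK (Set.Ioi x) = ENNReal.ofReal (1 - (∑' j : ℤ, (-1 : ℝ) ^ j * Real.exp (-2 * (j : ℝ) ^ 2 * x ^ 2))) := by
      rw [← hK x hx, ← Set.compl_Iic, ← ofReal_measureReal, probReal_compl_eq_one_sub measurableSet_Iic]
      rfl
    have h4 : 0 ≤ 1 - (∑' j : ℤ, (-1 : ℝ) ^ j * Real.exp (-2 * (j : ℝ) ^ 2 * x ^ 2)) := by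
      rw [← hK x hx]
      have := measureReal_le_one (μ := μK) (s := Set.Iic x)
      unfold Measure.real at this
      linarith
    rw [Measure.add_apply, h1, h2, h3, ← ENNReal.ofReal_add h4 (tsum_nonneg fun _ => by positivity),
      K_identity x hx]
  have hU : Set.Ioi (0:ℝ) = ⋃ n : ℕ, Set.Ioi (1 / ((n:ℝ) + 1)) := by
    ext v
    simp only [Set.mem_Ioi, Set.mem_iUnion]
    constructor
    · exact fun h => exists_nat_one_div_lt h
    · rintro ⟨n, hn⟩
      exact lt_trans (by positivity) hn
  rw [hU, Measure.restrict_iUnion_congr]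
  intro n
  have hn : 0 < 1 / ((n:ℝ) + 1) := by positivity
  set ε := 1 / ((n:ℝ) + 1)
  have hmax : ∀ a, 0 < max a ε := fun a => lt_max_of_lt_right hn
  have : IsFiniteMeasure ((μK + Measure.sum fun m : ℕ => nuK (2 * m + 2)).restrict (Set.Ioi ε)) :=
    ⟨by rw [Measure.restrict_apply_univ, (hIoi ε hn).1]; exact (hIoi ε hn).2.lt_top⟩
  refine ext_of_generate_finite _ (borel_eq_generateFrom_Ioi ℝ ▸ BorelSpace.measurable_eq) isPiSystem_Ioi ?_ ?_
  · rintro _ ⟨a, rfl⟩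
    rw [Measure.restrict_apply measurableSet_Ioi, Measure.restrict_apply measurableSet_Ioi,
      Set.Ioi_inter_Ioi]
    exact (hIoi _ (hmax a)).1
  · rw [Measure.restrict_apply_univ, Measure.restrict_apply_univ]
    exact (hIoi ε hn).1

lemma lint_pos (μK : Measure ℝ) [IsProbabilityMeasure μK]
    (hsupp : μK (Set.Iic 0) = 0)
    (hK : ∀ x : ℝ, 0 < x →
      (μK (Set.Iic x)).toReal = ∑' j : ℤ, (-1 : ℝ) ^ j * Real.exp (-2 * (j : ℝ) ^ 2 * x ^ 2))
    (t : ℝ) (ht : 0 < t) :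
    ∫⁻ v, ENNReal.ofReal (gK t v) ∂μK = ENNReal.ofReal (exp (-t) / (1 + exp (-t)) ^ 2) := by
  have hμ : μK.restrict (Set.Ioi 0) = μK := by
    apply Measure.restrict_eq_self_of_ae_mem
    rw [ae_iff]
    simp only [Set.mem_Ioi, not_lt]
    exact hsupp
  have hν : ∀ c, (nuK c).restrict (Set.Ioi 0) = nuK c := by
    intro c
    rw [nuK, restrict_withDensity measurableSet_Ioi, Measure.restrict_restrict measurableSet_Ioi,
      Set.inter_self]
  have h := meas_eq μK hK
  rw [Measure.restrict_add, Measure.restrict_sum _ measurableSet_Ioi,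
    Measure.restrict_sum _ measurableSet_Ioi, hμ] at h
  simp only [hν] at h
  have h' := congrArg (fun m => ∫⁻ v, ENNReal.ofReal (gK t v) ∂m) h
  simp only [lintegral_add_measure, lintegral_sum_measure] at h'
  set r := exp (-t) with hr
  have hr0 : 0 < r := exp_pos _
  have hr1 : r < 1 := by rw [hr, exp_lt_one_iff]; linarith
  have hodd : ∀ m : ℕ, ∫⁻ v, ENNReal.ofReal (gK t v) ∂(nuK (2 * m + 1))
      = ENNReal.ofReal ((2 * (m:ℝ) + 1) * r ^ (2 * m + 1)) := by
    intro m
    rw [lintegral_nuK _ _ (by positivity) ht, ← rpow_natCast]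
    push_cast
    rfl
  have heven : ∀ m : ℕ, ∫⁻ v, ENNReal.ofReal (gK t v) ∂(nuK (2 * m + 2))
      = ENNReal.ofReal ((2 * (m:ℝ) + 2) * r ^ (2 * m + 2)) := by
    intro m
    rw [lintegral_nuK _ _ (by positivity) ht, ← rpow_natCast]
    push_cast
    rfl
  simp only [hodd, heven] at h'
  have hsr : Summable fun n : ℕ => (n:ℝ) * r ^ n :=
    (hasSum_coe_mul_geometric_of_norm_lt_one (by rw [norm_of_nonneg hr0.le]; exact hr1)).summable
  have so : Summable fun m : ℕ => (2 * (m:ℝ) + 1) * r ^ (2 * m + 1) := by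
    refine (hsr.comp_injective (i := fun m : ℕ => 2 * m + 1) (fun a b h => by simpa using h)).congr fun m => ?_
    simp
  have se : Summable fun m : ℕ => (2 * (m:ℝ) + 2) * r ^ (2 * m + 2) := by
    refine (hsr.comp_injective (i := fun m : ℕ => 2 * m + 2) (fun a b h => by simpa using h)).congr fun m => ?_
    simp
  rw [← ENNReal.ofReal_tsum_of_nonneg (fun n => by positivity) so,
    ← ENNReal.ofReal_tsum_of_nonneg (fun n => by positivity) se] at h'
  have hN : HasSum (fun n : ℕ => ((n + 1 : ℕ) : ℝ) * (-r) ^ (n + 1))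
      (-(∑' m : ℕ, (2 * (m:ℝ) + 1) * r ^ (2 * m + 1)) + ∑' m : ℕ, (2 * (m:ℝ) + 2) * r ^ (2 * m + 2)) := by
    apply HasSum.even_add_odd
    · refine HasSum.congr_fun so.hasSum.neg fun m => ?_
      rw [Odd.neg_pow ⟨m, rfl⟩]
      push_cast
      ring
    · convert se.hasSum using 2 with m
      rw [Even.neg_pow ⟨m + 1, by ring⟩]
      push_cast
      ring
  have hM := (hasSum_nat_add_iff' 1).2 (hasSum_coe_mul_geometric_of_norm_lt_one (r := -r)
    (by rw [norm_neg, norm_of_nonneg hr0.le]; exact hr1))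
  have hE := hN.unique hM
  simp only [Finset.range_one, Finset.sum_singleton, Nat.cast_zero, zero_mul, sub_zero,
    sub_neg_eq_add, neg_div] at hE
  have hE' : (∑' m : ℕ, (2 * (m:ℝ) + 1) * r ^ (2 * m + 1)) = r / (1 + r) ^ 2 +
     ∑' m : ℕ, (2 * (m:ℝ) + 2) * r ^ (2 * m + 2) := by linarith
  rw [hE', ENNReal.ofReal_add (by positivity) (tsum_nonneg fun _ => by positivity)] at h'
  exact (ENNReal.add_left_inj ENNReal.ofReal_ne_top).1 h'

lemma lint_nonneg (μK : Measure ℝ) [IsProbabilityMeasure μK]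
    (hsupp : μK (Set.Iic 0) = 0)
    (hK : ∀ x : ℝ, 0 < x →
      (μK (Set.Iic x)).toReal = ∑' j : ℤ, (-1 : ℝ) ^ j * Real.exp (-2 * (j : ℝ) ^ 2 * x ^ 2))
    (t : ℝ) (ht : 0 ≤ t) :
    ∫⁻ v, ENNReal.ofReal (gK t v) ∂μK = ENNReal.ofReal (exp (-t) / (1 + exp (-t)) ^ 2) := by
  rcases ht.eq_or_lt with rfl | ht
  swap
  · exact lint_pos μK hsupp hK t ht
  have hu : Filter.Tendsto (fun n : ℕ => 1 / ((n:ℝ) + 1)) Filter.atTop (nhds 0) :=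
    tendsto_one_div_add_atTop_nhds_zero_nat
  have h1 : Filter.Tendsto (fun n : ℕ => ∫⁻ v, ENNReal.ofReal (gK (1 / ((n:ℝ) + 1)) v) ∂μK)
      Filter.atTop (nhds (∫⁻ v, ENNReal.ofReal (gK 0 v) ∂μK)) := by
    refine lintegral_tendsto_of_tendsto_of_monotone
      (fun n => (measurable_gK _).ennreal_ofReal.aemeasurable) ?_ ?_
    · refine Filter.Eventually.of_forall fun v n m hnm => ?_
      rcases le_or_gt v 0 with hv | hv
      · have : ∀ s, gK s v ≤ 0 := fun s => mul_nonpos_of_nonpos_of_nonneg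
          (one_div_nonpos.2 (by linarith)) (by positivity)
        simp only
        rw [ENNReal.ofReal_of_nonpos (this _), ENNReal.ofReal_of_nonpos (this _)]
      · apply ENNReal.ofReal_le_ofReal
        unfold gK
        have : 1 / ((m:ℝ) + 1) ≤ 1 / ((n:ℝ) + 1) := one_div_le_one_div_of_le (by positivity) (by
          have : (n:ℝ) ≤ m := by exact_mod_cast hnm
          linarith)
        have h0 : 0 ≤ 1 / ((m:ℝ) + 1) := by positivity
        simp only [neg_div]
        gcongr
    · refine Filter.Eventually.of_forall fun v => ?_
      have hc : Continuous fun s => ENNReal.ofReal (gK s v) := by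
        refine ENNReal.continuous_ofReal.comp ?_
        unfold gK
        fun_prop
      exact (hc.tendsto 0).comp hu
  have h2 : Filter.Tendsto (fun n : ℕ => ∫⁻ v, ENNReal.ofReal (gK (1 / ((n:ℝ) + 1)) v) ∂μK)
      Filter.atTop (nhds (ENNReal.ofReal (exp (-0) / (1 + exp (-0)) ^ 2))) := by
    have hc : Continuous fun s : ℝ => ENNReal.ofReal (exp (-s) / (1 + exp (-s)) ^ 2) := by
      refine ENNReal.continuous_ofReal.comp (Continuous.div (by fun_prop) (by fun_prop) fun s => ?_)
      positivity
    refine ((hc.tendsto 0).comp hu).congr fun n => ?_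
    exact (lint_pos μK hsupp hK _ (by positivity)).symm
  exact tendsto_nhds_unique h1 h2



/-- if `T | V ~ N(0, 4V²)` with `V` Kolmogorov-distributed
(CDF `K(x) = ∑_{j∈ℤ} (−1)^j exp(−2j²x²)` for `x > 0`), then `T` is standard
logistic: its density is `e^{−t}/(1+e^{−t})²`. -/
theorem stmt7
    (μK : Measure ℝ) [IsProbabilityMeasure μK]
    (hsupp : μK (Set.Iic 0) = 0)
    (hK : ∀ x : ℝ, 0 < x →
      (μK (Set.Iic x)).toReal = ∑' j : ℤ, (-1 : ℝ) ^ j * Real.exp (-2 * (j : ℝ) ^ 2 * x ^ 2)) :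
    ∀ t : ℝ,
      (∫ v, (1 / (2 * v)) *
          ((Real.sqrt (2 * Real.pi))⁻¹ * Real.exp (-(t / (2 * v)) ^ 2 / 2)) ∂μK) =
        Real.exp (-t) / (1 + Real.exp (-t)) ^ 2 := by
  intro t
  have hpos : ∀ᵐ v ∂μK, 0 < v := by
    rw [ae_iff]
    simp only [not_lt]
    exact hsupp
  have hlog : Real.exp (-t) / (1 + Real.exp (-t)) ^ 2
      = Real.exp (-|t|) / (1 + Real.exp (-|t|)) ^ 2 := by
    rcases abs_cases t with ⟨h, _⟩ | ⟨h, _⟩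
    · rw [h]
    · rw [h, neg_neg, Real.exp_neg]
      have := Real.exp_pos t
      field_simp
      ring
  have hg : ∀ v, gK t v = gK |t| v := by
    intro v
    simp only [gK, div_pow, sq_abs]
  change ∫ v, gK t v ∂μK = _
  rw [integral_eq_lintegral_of_nonneg_ae ?_ (measurable_gK t).aestronglyMeasurable, hlog]
  · simp only [hg]
    rw [lint_nonneg μK hsupp hK _ (abs_nonneg t), ENNReal.toReal_ofReal (by positivity)]
  · filter_upwards [hpos] with v hv
    simp only [gK, Pi.zero_apply]
    positivity
end

section
/- The logistic Kolmogorov density admits two equivalent series representations: for every v > 0, ∑_{j=1}^∞ (−1)^{j−1} j² exp(−j² v/2) = v^{−5/2} √(2π) ∑_{j=1}^∞ ((2j−1)² π² − v) exp(−(2j−1)² π² / (2v)). -/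
open Real

lemma aux_summable (N : ℕ → ℕ) (hN : Function.Injective N) (p : ℕ) (t : ℝ) (ht : 0 < t) :
    Summable (fun j => (N j : ℝ) ^ p * rexp (-t * N j)) :=
  (Real.summable_pow_mul_exp_neg_nat_mul p ht).comp_injective hN

lemma aux_deriv (N : ℕ → ℕ) (hN : Function.Injective N) (a : ℕ → ℝ) (ha : ∀ j, |a j| ≤ 1)
    (k : ℝ) (hk : 0 < k) (v : ℝ) (hv : 0 < v) :
    HasDerivAt (fun x => ∑' j, a j * rexp (-(k * x) * N j))
      (∑' j, a j * (rexp (-(k * v) * N j) * (-k * N j))) v := by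
  have hs : Summable (fun j => k * ((N j : ℝ) ^ 1 * rexp (-(k * (v / 2)) * N j))) :=
    (aux_summable N hN 1 (k * (v / 2)) (by positivity)).mul_left k
  have hs0 : Summable (fun j => a j * rexp (-(k * v) * N j)) := by
    refine Summable.of_norm_bounded (aux_summable N hN 0 (k * v) (by positivity)) fun j => ?_
    rw [norm_mul, Real.norm_eq_abs, Real.norm_eq_abs, abs_of_pos (exp_pos _), pow_zero]
    exact mul_le_mul_of_nonneg_right (ha j) (exp_pos _).le
  refine hasDerivAt_tsum_of_isPreconnected (g := fun j x => a j * rexp (-(k * x) * N j))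
    (g' := fun j x => a j * (rexp (-(k * x) * N j) * (-k * N j)))
    hs (isOpen_Ioi (a := v / 2)) isPreconnected_Ioi ?_ ?_ (y₀ := v) ?_ hs0 ?_
  · intro j y _
    have h1 : HasDerivAt (fun x : ℝ => -(k * x) * (N j : ℝ)) (-k * N j) y := by
      have := (((hasDerivAt_id y).const_mul k).neg).mul_const (N j : ℝ)
      simpa using this
    exact h1.exp.const_mul (a j)
  · intro j y hy
    have hy' : v / 2 < y := hy
    rw [norm_mul, norm_mul, Real.norm_eq_abs, Real.norm_eq_abs, Real.norm_eq_abs,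
      abs_of_pos (exp_pos _), abs_mul, abs_neg, abs_of_pos hk, Nat.abs_cast, pow_one]
    have h2 : rexp (-(k * y) * N j) ≤ rexp (-(k * (v / 2)) * N j) := by
      apply exp_le_exp.mpr
      apply mul_le_mul_of_nonneg_right _ (Nat.cast_nonneg _)
      have := mul_le_mul_of_nonneg_left hy'.le hk.le
      linarith
    calc |a j| * (rexp (-(k * y) * N j) * (k * N j))
        ≤ 1 * (rexp (-(k * (v / 2)) * N j) * (k * N j)) := by
          gcongr
          exact ha j
      _ = _ := by ring
  · simp [hv]
  · simp [hv]

lemma inj1 : Function.Injective (fun j : ℕ => (j + 1) ^ 2) := by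
  intro a b h
  have := Nat.pow_left_injective (n := 2) (by norm_num) h
  omega

lemma inj2 : Function.Injective (fun j : ℕ => (2 * j + 1) ^ 2) := by
  intro a b h
  have := Nat.pow_left_injective (n := 2) (by norm_num) h
  omega

lemma theta_id (v : ℝ) (hv : 0 < v) :
    ∑' j : ℕ, (-1 : ℝ) ^ j * rexp (-(1 / 2 * v) * ((j + 1) ^ 2 : ℕ)) =
      1 / 2 - √(2 * π) * v ^ (-(1 : ℝ) / 2) *
        ∑' j : ℕ, 1 * rexp (-(π ^ 2 / 2 * v⁻¹) * ((2 * j + 1) ^ 2 : ℕ)) := by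
  have hpi := Real.pi_pos
  set a : ℝ := v / (2 * π) with ha
  have ha0 : 0 < a := by positivity
  have key := Complex.tsum_exp_neg_quadratic (a := (a : ℂ)) (by simpa using ha0) (-Complex.I / 2)
  have e1 : ∀ n : ℤ, Complex.exp (-π * a * n ^ 2 + 2 * π * (-Complex.I / 2) * n) =
      (((-1 : ℝ) ^ n * rexp (-(1 / 2 * v) * n ^ 2) : ℝ) : ℂ) := by
    intro n
    rw [Complex.exp_add]
    have h1 : (2 * π * (-Complex.I / 2) * n : ℂ) = n * (-(π * Complex.I)) := by ring
    rw [h1, Complex.exp_int_mul, Complex.exp_neg, Complex.exp_pi_mul_I, mul_comm]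
    push_cast
    congr 2
    · norm_num
    · have : (π : ℂ) ≠ 0 := by exact_mod_cast hpi.ne'
      rw [ha]; push_cast; field_simp
  have e2 : ∀ n : ℤ, Complex.exp (-π / a * (n + Complex.I * (-Complex.I / 2)) ^ 2) =
      ((rexp (-(π ^ 2 / 2 * v⁻¹) * (2 * n + 1) ^ 2) : ℝ) : ℂ) := by
    intro n
    have h1 : Complex.I * (-Complex.I / 2) = 1 / 2 := by
      rw [mul_div_assoc', mul_neg, Complex.I_mul_I]; norm_num
    rw [h1]
    push_cast
    congr 1
    have : (π : ℂ) ≠ 0 := by exact_mod_cast hpi.ne'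
    have : (v : ℂ) ≠ 0 := by exact_mod_cast hv.ne'
    rw [ha]; push_cast; field_simp
    try ring
  simp_rw [e1, e2] at key
  have h3 : (1 / (a : ℂ) ^ (1 / 2 : ℂ)) = ((√(2 * π) * v ^ (-(1 : ℝ) / 2) : ℝ) : ℂ) := by
    have : ((a : ℂ) ^ (1 / 2 : ℂ)) = ((a ^ (1 / 2 : ℝ) : ℝ) : ℂ) := by
      rw [Complex.ofReal_cpow ha0.le]; norm_num
    rw [this, ← Complex.ofReal_one, ← Complex.ofReal_div]
    congr 1
    rw [ha, Real.div_rpow hv.le (by positivity), neg_div, Real.rpow_neg hv.le,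
      ← Real.sqrt_eq_rpow, ← Real.sqrt_eq_rpow]
    field_simp
  rw [h3, ← Complex.ofReal_tsum, ← Complex.ofReal_tsum, ← Complex.ofReal_mul] at key
  have key := Complex.ofReal_injective key
  have s1 := aux_summable _ inj1 0 (1 / 2 * v) (by positivity)
  have s2 := aux_summable _ inj2 0 (π ^ 2 / 2 * v⁻¹) (by positivity)
  have s1' : Summable (fun j : ℕ => (-1 : ℝ) ^ j * rexp (-(1 / 2 * v) * ((j + 1) ^ 2 : ℕ))) := by
    refine Summable.of_norm_bounded s1 fun j => ?_
    simp
  have f1 : ∀ n : ℕ, (-1 : ℝ) ^ ((n : ℤ) + 1) * rexp (-(1 / 2 * v) * (((n : ℤ) + 1 : ℤ) : ℝ) ^ 2) =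
      -((-1 : ℝ) ^ n * rexp (-(1 / 2 * v) * ((n + 1) ^ 2 : ℕ))) := by
    intro n
    rw [zpow_add₀ (by norm_num)]
    push_cast
    simp
  have f2 : ∀ n : ℕ, (-1 : ℝ) ^ (-((n : ℤ) + 1)) *
        rexp (-(1 / 2 * v) * ((-((n : ℤ) + 1) : ℤ) : ℝ) ^ 2) =
      -((-1 : ℝ) ^ n * rexp (-(1 / 2 * v) * ((n + 1) ^ 2 : ℕ))) := by
    intro n
    rw [← f1, zpow_neg, ← inv_zpow]
    push_cast
    rw [neg_sq]; norm_num
  have g1 : ∀ n : ℕ, rexp (-(π ^ 2 / 2 * v⁻¹) * (2 * ((n : ℤ) : ℝ) + 1) ^ 2) =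
      1 * rexp (-(π ^ 2 / 2 * v⁻¹) * ((2 * n + 1) ^ 2 : ℕ)) := by
    intro n; push_cast; ring_nf
  have g2 : ∀ n : ℕ, rexp (-(π ^ 2 / 2 * v⁻¹) * (2 * ((-((n : ℤ) + 1) : ℤ) : ℝ) + 1) ^ 2) =
      1 * rexp (-(π ^ 2 / 2 * v⁻¹) * ((2 * n + 1) ^ 2 : ℕ)) := by
    intro n; push_cast; ring_nf
  simp only [pow_zero] at s2
  rw [tsum_of_add_one_of_neg_add_one (by simp_rw [f1]; exact s1'.neg)
    (by simp_rw [f2]; exact s1'.neg),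
    tsum_of_nat_of_neg_add_one (by simp_rw [g1]; exact s2) (by simp_rw [g2]; exact s2)] at key
  simp_rw [f1, f2, g1, g2] at key
  rw [tsum_neg] at key
  simp only [zpow_zero, Int.cast_zero] at key
  norm_num at key ⊢
  linarith

theorem stmt9 :
    ∀ v : ℝ, 0 < v →
      (∑' j : ℕ, (-1 : ℝ) ^ j * ((j : ℝ) + 1) ^ 2 * Real.exp (-((j : ℝ) + 1) ^ 2 * v / 2)) =
        v ^ (-(5 : ℝ) / 2) * Real.sqrt (2 * Real.pi) *
          ∑' j : ℕ, ((2 * (j : ℝ) + 1) ^ 2 * Real.pi ^ 2 - v) *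
            Real.exp (-((2 * (j : ℝ) + 1) ^ 2 * Real.pi ^ 2) / (2 * v)) := by
  intro v hv
  have hpi := Real.pi_pos
  have d1 := aux_deriv _ inj1 (fun j => (-1) ^ j) (by simp) (1 / 2) (by norm_num) v hv
  have d2 := (aux_deriv _ inj2 (fun _ => 1) (by simp) (π ^ 2 / 2) (by positivity) v⁻¹
    (by positivity)).comp v (hasDerivAt_inv hv.ne')
  have d3 : HasDerivAt (fun x : ℝ => √(2 * π) * x ^ (-(1 : ℝ) / 2))
      (√(2 * π) * (-(1 : ℝ) / 2 * v ^ (-(1 : ℝ) / 2 - 1))) v :=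
    (Real.hasDerivAt_rpow_const (Or.inl hv.ne')).const_mul _
  have d4 := (d3.mul d2).const_sub (1 / 2)
  have heq := d1.unique (d4.congr_of_eventuallyEq (by
    filter_upwards [lt_mem_nhds hv] with x hx
    exact theta_id x hx))
  have s0 := aux_summable _ inj2 0 (π ^ 2 / 2 * v⁻¹) (by positivity)
  have s1 := aux_summable _ inj2 1 (π ^ 2 / 2 * v⁻¹) (by positivity)
  simp only [pow_zero, pow_one, one_mul] at s0 s1
  have L : ∑' j : ℕ, (-1 : ℝ) ^ j * ((j : ℝ) + 1) ^ 2 * rexp (-((j : ℝ) + 1) ^ 2 * v / 2) =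
      -2 * ∑' j : ℕ, (-1 : ℝ) ^ j * (rexp (-(1 / 2 * v) * ((j + 1) ^ 2 : ℕ)) *
        (-(1 / 2) * ((j + 1) ^ 2 : ℕ))) := by
    rw [← tsum_mul_left]
    refine tsum_congr fun j => ?_
    push_cast
    rw [show -((j : ℝ) + 1) ^ 2 * v / 2 = -(1 / 2 * v) * ((j : ℝ) + 1) ^ 2 by ring]
    ring
  have R : ∑' j : ℕ, ((2 * (j : ℝ) + 1) ^ 2 * π ^ 2 - v) *
        rexp (-((2 * (j : ℝ) + 1) ^ 2 * π ^ 2) / (2 * v)) =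
      π ^ 2 * ∑' j : ℕ, (((2 * j + 1) ^ 2 : ℕ) : ℝ) *
          rexp (-(π ^ 2 / 2 * v⁻¹) * ((2 * j + 1) ^ 2 : ℕ)) -
        v * ∑' j : ℕ, rexp (-(π ^ 2 / 2 * v⁻¹) * ((2 * j + 1) ^ 2 : ℕ)) := by
    rw [← tsum_mul_left, ← tsum_mul_left, ← (s1.mul_left _).tsum_sub (s0.mul_left _)]
    refine tsum_congr fun j => ?_
    push_cast
    rw [show -((2 * (j : ℝ) + 1) ^ 2 * π ^ 2) / (2 * v) =
      -(π ^ 2 / 2 * v⁻¹) * (2 * (j : ℝ) + 1) ^ 2 by field_simp]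
    ring
  have M : ∑' j : ℕ, 1 * (rexp (-(π ^ 2 / 2 * v⁻¹) * ((2 * j + 1) ^ 2 : ℕ)) *
        (-(π ^ 2 / 2) * ((2 * j + 1) ^ 2 : ℕ))) =
      -(π ^ 2 / 2) * ∑' j : ℕ, (((2 * j + 1) ^ 2 : ℕ) : ℝ) *
          rexp (-(π ^ 2 / 2 * v⁻¹) * ((2 * j + 1) ^ 2 : ℕ)) := by
    rw [← tsum_mul_left]
    exact tsum_congr fun j => by ring
  simp only [Function.comp_def] at heq
  rw [L, heq, R, M]
  simp only [one_mul]
  have r1 : v ^ (-(1 : ℝ) / 2 - 1) = v ^ (-(5 : ℝ) / 2) * v := by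
    rw [← Real.rpow_add_one hv.ne']; norm_num
  have r2 : v ^ (-(1 : ℝ) / 2) = v ^ (-(5 : ℝ) / 2) * v ^ 2 := by
    rw [← Real.rpow_add_natCast hv.ne']; norm_num
  rw [r1, r2]
  field_simp
  ring
end
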